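/- Assume the ETR premise. Then the set Y = {(x,n) ∈ X × ℕ | φ₀(n,x,f) for some x-approximation f} satisfies H_φ(X,Y), i.e., for all x ∈ X and n ∈ ℕ, (x,n) ∈ Y if and only if φ(n,x,Y^x). In particular, there exists a set Y ⊆ X × ℕ with H_φ(X,Y). -/

import Mathlib

/-- `H_φ(X↾x, Y)` restriction operation: `Y^x = {(x',n) ∈ Y | x' < x}`. -/
def restrictS {X : Type*} [LinearOrder X] (Z : Set (X × ℕ)) (x : X) : Set (X × ℕ) :=
  {p ∈ Z | p.1 < x}

/-- `H_φ(X, Y)`: for all `x ∈ X` and `n ∈ ℕ`, `(x,n) ∈ Y ↔ φ(n, x, Y^x)`. -/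
def Hfull {X : Type*} [LinearOrder X]
    (φ : ℕ → X → Set (X × ℕ) → Prop) (Y : Set (X × ℕ)) : Prop :=
  ∀ (x : X) (n : ℕ), (x, n) ∈ Y ↔ φ n x (restrictS Y x)

/-- `H_φ(X↾x, Z)`: `Z ⊆ {(x',n) | x' < x}` and for all `x' < x` and `n`,
`(x',n) ∈ Z ↔ φ(n, x', Z^{x'})`. -/
def Hres {X : Type*} [LinearOrder X]
    (φ : ℕ → X → Set (X × ℕ) → Prop) (x : X) (Z : Set (X × ℕ)) : Prop :=
  (∀ p ∈ Z, p.1 < x) ∧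
  ∀ (x' : X) (n : ℕ), x' < x → ((x', n) ∈ Z ↔ φ n x' (restrictS Z x'))

/-- A partial function `X × ℕ → Option Bool` is finite if its support is finite. -/
def FinSupp {X : Type*} (f : X × ℕ → Option Bool) : Prop :=
  {p | f p ≠ none}.Finite

/-- `f ⪯ g`: every defined value of `f` is a defined value of `g` with the same value. -/
def PLE {X : Type*} (f g : X × ℕ → Option Bool) : Prop :=
  ∀ p b, f p = some b → g p = some b

/-- `f ⪯ Z` for a set `Z ⊆ X × ℕ` (identified with its characteristic function). -/
def PLESet {X : Type*} (f : X × ℕ → Option Bool) (Z : Set (X × ℕ)) : Prop :=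
  ∀ p : X × ℕ, (f p = some true → p ∈ Z) ∧ (f p = some false → p ∉ Z)

/-- `f↾x`: restriction of `f` to arguments `(x',n)` with `x' < x`. -/
def restrictF {X : Type*} [LinearOrder X] (f : X × ℕ → Option Bool) (x : X) :
    X × ℕ → Option Bool :=
  fun p => if p.1 < x then f p else none

/-- `g` is an `x`-extension of `f`: `f ⪯ g` and whenever `g(x',n)` is defined but
`f(x',n)` is not, we have `x ≤ x'` and `g(x',n) = false`. -/
def IsExtension {X : Type*} [LinearOrder X] (x : X) (f g : X × ℕ → Option Bool) : Prop :=
  PLE f g ∧ ∀ p : X × ℕ, g p ≠ none → f p = none → x ≤ p.1 ∧ g p = some false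

/-- `f` is an `x`-approximation (relative to `φ₀` and `ψ₀`). -/
def IsApprox {X : Type*} [LinearOrder X]
    (φ₀ ψ₀ : ℕ → X → (X × ℕ → Option Bool) → Prop) (x : X)
    (f : X × ℕ → Option Bool) : Prop :=
  FinSupp f ∧
  (∀ (x' : X) (n : ℕ) (b : Bool), f (x', n) = some b → x ≤ x' → b = false) ∧
  (∀ (x' : X) (n : ℕ), x' < x → f (x', n) = some true →
    ∃ h, FinSupp h ∧ IsExtension x' (restrictF f x') h ∧ φ₀ n x' h) ∧
  (∀ (x' : X) (n : ℕ), x' < x → f (x', n) = some false →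
    ∃ h, FinSupp h ∧ IsExtension x' (restrictF f x') h ∧ ψ₀ n x' h)

/-- `φ(n,x,Z)`: there is a finite partial function `f ⪯ Z` with `φ₀(n,x,f)`. -/
def phi {X : Type*} (φ₀ : ℕ → X → (X × ℕ → Option Bool) → Prop)
    (n : ℕ) (x : X) (Z : Set (X × ℕ)) : Prop :=
  ∃ f, FinSupp f ∧ PLESet f Z ∧ φ₀ n x f

/-- The premise of effective transfinite recursion. -/
def ETRPremise {X : Type*} [LinearOrder X]
    (φ₀ ψ₀ : ℕ → X → (X × ℕ → Option Bool) → Prop) : Prop :=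
  ∀ (x : X) (Z : Set (X × ℕ)), Hres (phi φ₀) x Z →
    ∀ n : ℕ, (phi φ₀ n x Z ↔ ¬ phi ψ₀ n x Z)

/-- Transfinite recursion along a well-founded order: `Hfull φ` has a solution. -/
theorem exists_Hfull {X : Type*} [LinearOrder X] (hwf : WellFounded ((· < ·) : X → X → Prop))
    (φ : ℕ → X → Set (X × ℕ) → Prop) : ∃ Y, Hfull φ Y := by
  let F : ∀ x : X, (∀ y : X, y < x → Set ℕ) → Set ℕ :=
    fun x P => {n | φ n x {p | ∃ h : p.1 < x, p.2 ∈ P p.1 h}}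
  refine ⟨{p | p.2 ∈ hwf.fix F p.1}, fun x n => ?_⟩
  have key : n ∈ hwf.fix F x ↔ φ n x {p | ∃ _ : p.1 < x, p.2 ∈ hwf.fix F p.1} := by
    rw [hwf.fix_eq]
    rfl
  have hset : {p : X × ℕ | ∃ _ : p.1 < x, p.2 ∈ hwf.fix F p.1} =
      restrictS {p | p.2 ∈ hwf.fix F p.1} x := by
    ext p
    simp [restrictS, and_comm]
  rw [hset] at key
  exact key

/-- Initial segments of a solution of `Hfull φ` are solutions of `Hres φ`. -/
theorem Hfull.hres {X : Type*} [LinearOrder X] {φ : ℕ → X → Set (X × ℕ) → Prop}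
    {Y : Set (X × ℕ)} (hY : Hfull φ Y) (x : X) : Hres φ x (restrictS Y x) := by
  refine ⟨fun p hp => hp.2, fun x' n hx' => ?_⟩
  have hset : restrictS (restrictS Y x) x' = restrictS Y x' := by
    ext p
    exact ⟨fun h => ⟨h.1.1, h.2⟩, fun h => ⟨⟨h.1, h.2.trans hx'⟩, h.2⟩⟩
  rw [hset, ← hY x' n]
  exact ⟨fun h => h.1, fun h => ⟨h, hx'⟩⟩

/-- An `x`-extension of a finite partial function compatible with `Y` below `x` is compatible
with the initial segment of `Y` below `x`. -/
theorem IsExtension.pleSet {X : Type*} [LinearOrder X] {x : X} {f h : X × ℕ → Option Bool}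
    {Y : Set (X × ℕ)} (hext : IsExtension x (restrictF f x) h)
    (hf : ∀ p : X × ℕ, p.1 < x → (f p = some true → p ∈ Y) ∧ (f p = some false → p ∉ Y)) :
    PLESet h (restrictS Y x) := by
  intro p
  by_cases hp : p.1 < x
  · have hval : ∀ b, h p = some b → f p = some b := by
      intro b hb
      cases hfp : f p with
      | none =>
        have := (hext.2 p (by simp [hb]) (by simp [restrictF, hp, hfp])).1
        exact absurd hp this.not_gt
      | some c =>
        rw [← hb, hext.1 p c (by simp [restrictF, hp, hfp])]
    exact ⟨fun ht => ⟨(hf p hp).1 (hval _ ht), hp⟩, fun ht hm => (hf p hp).2 (hval _ ht) hm.1⟩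
  · refine ⟨fun ht => ?_, fun _ hm => hp hm.2⟩
    have := (hext.2 p (by simp [ht]) (by simp [restrictF, hp])).2
    simp [ht] at this

/-- Every `x`-approximation is compatible with every solution of the recursion. -/
theorem IsApprox.pleSet {X : Type*} [LinearOrder X]
    (hwf : WellFounded ((· < ·) : X → X → Prop))
    {φ₀ ψ₀ : ℕ → X → (X × ℕ → Option Bool) → Prop} (hprem : ETRPremise φ₀ ψ₀)
    {Y : Set (X × ℕ)} (hY : Hfull (phi φ₀) Y) {x : X} {f : X × ℕ → Option Bool}
    (hf : IsApprox φ₀ ψ₀ x f) : PLESet f (restrictS Y x) := by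
  obtain ⟨-, hge, htrue, hfalse⟩ := hf
  have below : ∀ x' : X, x' < x → ∀ n : ℕ,
      (f (x', n) = some true → (x', n) ∈ Y) ∧ (f (x', n) = some false → (x', n) ∉ Y) := by
    intro x'
    induction x' using hwf.induction with
    | _ x' ih =>
      intro hx' n
      have hlow : ∀ p : X × ℕ, p.1 < x' →
          (f p = some true → p ∈ Y) ∧ (f p = some false → p ∉ Y) :=
        fun p hp => ih p.1 hp (hp.trans hx') p.2
      refine ⟨fun h => ?_, fun h hm => ?_⟩
      · obtain ⟨g, hg, hext, hφ⟩ := htrue x' n hx' h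
        exact (hY x' n).2 ⟨g, hg, hext.pleSet hlow, hφ⟩
      · obtain ⟨g, hg, hext, hψ⟩ := hfalse x' n hx' h
        exact (hprem x' _ (hY.hres x') n).1 ((hY x' n).1 hm) ⟨g, hg, hext.pleSet hlow, hψ⟩
  rintro ⟨x', n⟩
  by_cases hx' : x' < x
  · exact ⟨fun h => ⟨(below x' hx' n).1 h, hx'⟩, fun h hm => (below x' hx' n).2 h hm.1⟩
  · refine ⟨fun h => ?_, fun _ hm => hx' hm.2⟩
    simpa using hge x' n true h (not_lt.1 hx')

/-- A finitely branching dependency relation that decreases along a well-founded order admits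
finite closed sets containing any given point. -/
theorem exists_finite_closed {X : Type*} [LinearOrder X]
    (hwf : WellFounded ((· < ·) : X → X → Prop)) {N : X × ℕ → Set (X × ℕ)}
    (hN : ∀ p, (N p).Finite) (p : X × ℕ) :
    ∃ S : Set (X × ℕ), S.Finite ∧ p ∈ S ∧ ∀ q ∈ S, ∀ r ∈ N q, r.1 < q.1 → r ∈ S := by
  obtain ⟨x, n⟩ := p
  induction x using hwf.induction generalizing n with
  | _ x ih =>
    choose! T hfin hmem hcl using ih
    refine ⟨{(x, n)} ∪ ⋃ q ∈ {q ∈ N (x, n) | q.1 < x}, T q.1 q.2,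
      (Set.finite_singleton _).union (((hN (x, n)).subset (Set.sep_subset _ _)).biUnion
        fun q hq => hfin q.1 hq.2 q.2), Or.inl rfl, ?_⟩
    rintro q (rfl | hq) r hr hrq
    · exact Or.inr (Set.mem_biUnion (show r ∈ {q ∈ N (x, n) | q.1 < x} from ⟨hr, hrq⟩)
        (hmem r.1 hrq r.2))
    · obtain ⟨s, hs, hqs⟩ := Set.mem_iUnion₂.1 hq
      exact Or.inr (Set.mem_biUnion hs (hcl s.1 hs.2 s.2 q hqs r hr hrq))

open Classical in
/-- The characteristic function of `Z`, defined on the points of `S` only. -/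
noncomputable def partialChar {X : Type*} (S Z : Set (X × ℕ)) : X × ℕ → Option Bool :=
  fun p => if p ∈ S then some (decide (p ∈ Z)) else none

theorem partialChar_of_mem {X : Type*} {S Z : Set (X × ℕ)} {p : X × ℕ} (hp : p ∈ S) :
    ∃ b, partialChar S Z p = some b ∧ (b = true ↔ p ∈ Z) := by
  classical
  exact ⟨decide (p ∈ Z), by simp [partialChar, hp], by simp⟩

theorem partialChar_of_notMem {X : Type*} {S Z : Set (X × ℕ)} {p : X × ℕ} (hp : p ∉ S) :
    partialChar S Z p = none := by
  simp [partialChar, hp]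

theorem partialChar_eq_some {X : Type*} {S Z : Set (X × ℕ)} {p : X × ℕ} {b : Bool}
    (h : partialChar S Z p = some b) : p ∈ S ∧ (b = true ↔ p ∈ Z) := by
  by_cases hp : p ∈ S
  · obtain ⟨c, hc, hcz⟩ := partialChar_of_mem (Z := Z) hp
    obtain rfl : c = b := by simpa [hc] using h
    exact ⟨hp, hcz⟩
  · simp [partialChar_of_notMem hp] at h

theorem finSupp_partialChar {X : Type*} {S : Set (X × ℕ)} (hS : S.Finite) (Z : Set (X × ℕ)) :
    FinSupp (partialChar S Z) :=
  hS.subset fun p hp => by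
    by_contra hpS
    exact hp (partialChar_of_notMem hpS)

theorem PLESet.ple_partialChar {X : Type*} {S Z : Set (X × ℕ)} {g : X × ℕ → Option Bool}
    (hg : PLESet g Z) (hS : ∀ p, g p ≠ none → p ∈ S) : PLE g (partialChar S Z) := by
  intro p b hb
  obtain ⟨c, hc, hcz⟩ := partialChar_of_mem (Z := Z) (hS p (by simp [hb]))
  rw [hc]
  cases b with
  | true => rw [hcz.2 ((hg p).1 hb)]
  | false =>
    cases c with
    | true => exact absurd (hcz.1 rfl) ((hg p).2 hb)
    | false => rfl

/-- Amalgamation: a finite `g ⪯ Y^x'` whose points below `x'` lie in `S` extends to an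
`x'`-extension of the restriction to `x'` of the partial characteristic function of `Y^x`. -/
theorem exists_isExtension_partialChar {X : Type*} [LinearOrder X] {S Y : Set (X × ℕ)}
    {x x' : X} (hx' : x' < x) (hS : S.Finite) {g : X × ℕ → Option Bool} (hg : FinSupp g)
    (hgY : PLESet g (restrictS Y x')) (hgS : ∀ p, g p ≠ none → p.1 < x' → p ∈ S) :
    ∃ h, FinSupp h ∧ IsExtension x' (restrictF (partialChar S (restrictS Y x)) x') h ∧
      PLE g h := by
  have hbelow : ∀ p : X × ℕ, p.1 < x' → (p ∈ restrictS Y x ↔ p ∈ restrictS Y x') :=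
    fun p hp => ⟨fun h => ⟨h.1, hp⟩, fun h => ⟨h.1, hp.trans hx'⟩⟩
  let U : Set (X × ℕ) := {p ∈ S | p.1 < x'} ∪ {p | g p ≠ none}
  refine ⟨partialChar U (restrictS Y x'),
    finSupp_partialChar ((hS.subset (Set.sep_subset _ _)).union hg) _, ⟨?_, ?_⟩,
    hgY.ple_partialChar fun p hp => Or.inr hp⟩
  · intro p b hb
    by_cases hp : p.1 < x'
    · simp only [restrictF, hp, if_true] at hb
      obtain ⟨hpS, hbz⟩ := partialChar_eq_some hb
      obtain ⟨c, hc, hcz⟩ := partialChar_of_mem (Z := restrictS Y x')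
        (show p ∈ U from Or.inl ⟨hpS, hp⟩)
      rw [hc, Option.some_inj, Bool.eq_iff_iff, hcz, hbz, hbelow p hp]
    · simp [restrictF, hp] at hb
  · intro p hp hnone
    obtain ⟨b, hb⟩ := Option.ne_none_iff_exists'.1 hp
    obtain ⟨hpU, hbz⟩ := partialChar_eq_some hb
    have hge : ¬ p.1 < x' := by
      intro hlt
      have hpS : p ∈ S := hpU.elim (fun h => h.1) fun h => hgS p h hlt
      obtain ⟨c, hc, -⟩ := partialChar_of_mem (Z := restrictS Y x) hpS
      simp [restrictF, hlt, hc] at hnone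
    refine ⟨not_lt.1 hge, ?_⟩
    cases b with
    | true => exact absurd (hbz.1 rfl).2 hge
    | false => exact hb

/-- Every finite partial function compatible with `Y^x` extends to an `x`-approximation, for `Y`
a solution of the recursion. -/
theorem exists_isApprox_extending {X : Type*} [LinearOrder X]
    (hwf : WellFounded ((· < ·) : X → X → Prop))
    {φ₀ ψ₀ : ℕ → X → (X × ℕ → Option Bool) → Prop}
    (hφmono : ∀ (n : ℕ) (x : X) (f g : X × ℕ → Option Bool),
      FinSupp f → FinSupp g → φ₀ n x f → PLE f g → φ₀ n x g)
    (hψmono : ∀ (n : ℕ) (x : X) (f g : X × ℕ → Option Bool),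
      FinSupp f → FinSupp g → ψ₀ n x f → PLE f g → ψ₀ n x g)
    (hprem : ETRPremise φ₀ ψ₀) {Y : Set (X × ℕ)} (hY : Hfull (phi φ₀) Y) {x : X}
    {g : X × ℕ → Option Bool} (hg : FinSupp g) (hgY : PLESet g (restrictS Y x)) :
    ∃ f, IsApprox φ₀ ψ₀ x f ∧ PLE g f := by
  have hwit : ∀ p : X × ℕ, ∃ h, FinSupp h ∧ PLESet h (restrictS Y p.1) ∧
      (p ∈ Y → φ₀ p.2 p.1 h) ∧ (p ∉ Y → ψ₀ p.2 p.1 h) := by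
    intro p
    by_cases hp : p ∈ Y
    · obtain ⟨h, hh, hhY, hφ⟩ := (hY p.1 p.2).1 hp
      exact ⟨h, hh, hhY, fun _ => hφ, fun hn => absurd hp hn⟩
    · have hψ : phi ψ₀ p.2 p.1 (restrictS Y p.1) := by
        by_contra hn
        exact hp ((hY p.1 p.2).2 ((hprem p.1 _ (hY.hres p.1) p.2).2 hn))
      obtain ⟨h, hh, hhY, hψ⟩ := hψ
      exact ⟨h, hh, hhY, fun hm => absurd hm hp, fun _ => hψ⟩
  choose w hwfin hwY hwφ hwψ using hwit
  choose T hTfin hTmem hTcl using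
    exists_finite_closed hwf (N := fun p => {q | w p q ≠ none}) hwfin
  let S : Set (X × ℕ) := ⋃ p ∈ {p | g p ≠ none}, T p
  have hSfin : S.Finite := Set.Finite.biUnion hg fun p _ => hTfin p
  have hScl : ∀ q ∈ S, ∀ r, w q r ≠ none → r.1 < q.1 → r ∈ S := by
    intro q hq r hr hrq
    obtain ⟨p, hp, hqp⟩ := Set.mem_iUnion₂.1 hq
    exact Set.mem_biUnion hp (hTcl p q hqp r hr hrq)
  refine ⟨partialChar S (restrictS Y x), ⟨finSupp_partialChar hSfin _, ?_, ?_, ?_⟩,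
    hgY.ple_partialChar fun p hp => Set.mem_biUnion (show p ∈ {p | g p ≠ none} from hp)
      (hTmem p)⟩
  · intro x' n b hb hx'
    cases b with
    | true => exact absurd ((partialChar_eq_some hb).2.1 rfl).2 hx'.not_gt
    | false => rfl
  all_goals
    intro x' n hx' hb
    obtain ⟨hpS, hbz⟩ := partialChar_eq_some hb
    obtain ⟨h, hh, hext, hle⟩ := exists_isExtension_partialChar hx' hSfin (hwfin (x', n))
      (hwY (x', n)) (hScl (x', n) hpS)
    refine ⟨h, hh, hext, ?_⟩
  · exact hφmono n x' _ h (hwfin (x', n)) hh (hwφ (x', n) (hbz.1 rfl).1) hle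
  · exact hψmono n x' _ h (hwfin (x', n)) hh
      (hwψ (x', n) fun hm => Bool.false_ne_true (hbz.2 ⟨hm, hx'⟩)) hle

/-- under the ETR premise, the set
`Y = {(x,n) | φ₀(n,x,f) for some x-approximation f}` satisfies `H_φ(X,Y)`;
in particular, there exists a set `Y` with `H_φ(X,Y)`. -/
theorem stmt_8 {X : Type*} [LinearOrder X]
    (hwf : WellFounded ((· < ·) : X → X → Prop))
    (φ₀ ψ₀ : ℕ → X → (X × ℕ → Option Bool) → Prop)
    (hφmono : ∀ (n : ℕ) (x : X) (f g : X × ℕ → Option Bool),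
      FinSupp f → FinSupp g → φ₀ n x f → PLE f g → φ₀ n x g)
    (hψmono : ∀ (n : ℕ) (x : X) (f g : X × ℕ → Option Bool),
      FinSupp f → FinSupp g → ψ₀ n x f → PLE f g → ψ₀ n x g)
    (hprem : ETRPremise φ₀ ψ₀) :
    Hfull (phi φ₀) {p : X × ℕ | ∃ f, IsApprox φ₀ ψ₀ p.1 f ∧ φ₀ p.2 p.1 f} ∧
      ∃ Y : Set (X × ℕ), Hfull (phi φ₀) Y := by
  obtain ⟨Y, hY⟩ := exists_Hfull hwf (phi φ₀)
  have hset : {p : X × ℕ | ∃ f, IsApprox φ₀ ψ₀ p.1 f ∧ φ₀ p.2 p.1 f} = Y := by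
    ext ⟨x, n⟩
    rw [hY x n]
    constructor
    · rintro ⟨f, hf, hφ⟩
      exact ⟨f, hf.1, hf.pleSet hwf hprem hY, hφ⟩
    · rintro ⟨g, hg, hgY, hφ⟩
      obtain ⟨f, hf, hle⟩ := exists_isApprox_extending hwf hφmono hψmono hprem hY hg hgY
      exact ⟨f, hf, hφmono n x g f hg hf.1 hφ hle⟩
  rw [hset]
  exact ⟨hY, Y, hY⟩
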